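/- Let r ≥ 1 and d ≥ 2 be integers, and let N be the set of r-tuples in SO(d)^r that are not generic. Then N is a meager subset of SO(d)^r with respect to the topology induced by the Euclidean topology on ℝ^{d²r} ⊇ SO(d)^r. -/

import Mathlib

open MeasureTheory

/-- The set of special orthogonal `d × d` real matrices. -/
def SOSet (d : ℕ) : Set (Matrix (Fin d) (Fin d) ℝ) :=
  {M | M.transpose * M = 1 ∧ M.det = 1}

/-- An `r`-tuple of `d × d` real matrices is *generic* if every polynomial with rational
coefficients in the `d²r` matrix entries that vanishes on it vanishes on all of `SO(d)^r`. -/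
def IsGeneric {d r : ℕ} (γ : Fin r → Matrix (Fin d) (Fin d) ℝ) : Prop :=
  ∀ p : MvPolynomial (Fin r × Fin d × Fin d) ℚ,
    MvPolynomial.aeval (fun q => γ q.1 q.2.1 q.2.2) p = 0 →
    ∀ β : Fin r → Matrix (Fin d) (Fin d) ℝ, (∀ s, β s ∈ SOSet d) →
      MvPolynomial.aeval (fun q => β q.1 q.2.1 q.2.2) p = 0

open Matrix Topology

section Householder

variable {n : Type*} [Fintype n] [DecidableEq n]

/-- The matrix of the reflection in the hyperplane orthogonal to `v` (the identity if `v = 0`). -/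
noncomputable def householder (v : n → ℝ) : Matrix n n ℝ :=
  1 - (2 / (v ⬝ᵥ v)) • vecMulVec v v

theorem householder_apply (v : n → ℝ) (i j : n) :
    householder v i j = (1 : Matrix n n ℝ) i j - 2 / (v ⬝ᵥ v) * (v i * v j) := by
  simp [householder, vecMulVec_apply]

@[simp]
theorem householder_zero : householder (0 : n → ℝ) = 1 := by
  simp [householder]

theorem householder_transpose (v : n → ℝ) : (householder v)ᵀ = householder v := by
  simp [householder, transpose_vecMulVec]

theorem householder_smul {a : ℝ} (ha : a ≠ 0) (v : n → ℝ) :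
    householder (a • v) = householder v := by
  ext i j
  simp only [householder_apply, smul_dotProduct, dotProduct_smul, smul_eq_mul, Pi.smul_apply]
  field_simp

theorem householder_mul_self (v : n → ℝ) : householder v * householder v = 1 := by
  rcases eq_or_ne v 0 with rfl | hv
  · simp
  have h : v ⬝ᵥ v ≠ 0 := by simpa using hv
  have hsq : vecMulVec v v * vecMulVec v v = (v ⬝ᵥ v) • vecMulVec v v := by
    rw [vecMulVec_mul_vecMulVec, vecMulVec_smul]
  simp only [householder, mul_sub, sub_mul, mul_one, one_mul, smul_mul_assoc, mul_smul_comm, hsq]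
  match_scalars
  · norm_num
  · field_simp
    norm_num

theorem det_householder {v : n → ℝ} (hv : v ≠ 0) : (householder v).det = -1 := by
  have h : v ⬝ᵥ v ≠ 0 := by simpa using hv
  have hrank : householder v =
      1 + replicateCol Unit (-(2 / (v ⬝ᵥ v)) • v) * replicateRow Unit v := by
    ext i j
    simp [householder_apply, mul_apply]
    ring
  rw [hrank, det_one_add_replicateCol_mul_replicateRow, dotProduct_smul, smul_eq_mul]
  field_simp
  norm_num

theorem toEuclideanCLM_householder (v : EuclideanSpace ℝ n) :
    toEuclideanCLM (𝕜 := ℝ) (householder v.ofLp) =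
      ((ℝ ∙ v)ᗮ.reflection : EuclideanSpace ℝ n →L[ℝ] EuclideanSpace ℝ n) := by
  ext x i
  have hn : ‖v‖ ^ 2 = v.ofLp ⬝ᵥ v.ofLp := by
    rw [EuclideanSpace.norm_sq_eq]; simp [dotProduct, sq]
  have hi : inner ℝ v x = v.ofLp ⬝ᵥ x.ofLp := by
    simp [PiLp.inner_apply, dotProduct, mul_comm]
  have hr : (ℝ ∙ v)ᗮ.reflection x = -(ℝ ∙ v).reflection x :=
    Submodule.reflection_orthogonal_apply _ x
  have hs := Submodule.reflection_singleton_apply (𝕜 := ℝ) v x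
  simp only [RCLike.ofReal_real_eq_id, id_eq] at hs
  rw [hn, hi] at hs
  simp [householder, vecMulVec_mulVec, hr, hs]
  ring

/-- **Cartan–Dieudonné theorem** for real matrices. -/
theorem exists_eq_prod_householder {M : Matrix n n ℝ} (hM : Mᵀ * M = 1) :
    ∃ l : List (n → ℝ), M = (l.map householder).prod := by
  have hMu : M ∈ unitary (Matrix n n ℝ) := by
    rw [Unitary.mem_iff]
    exact ⟨by simpa [star_eq_conjTranspose] using hM,
      by simpa [star_eq_conjTranspose] using mul_eq_one_comm.mp hM⟩
  have hTu : toEuclideanCLM (𝕜 := ℝ) M ∈ unitary _ := Unitary.map_mem _ hMu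
  obtain ⟨l, -, hl⟩ :=
    (Unitary.linearIsometryEquiv ⟨_, hTu⟩).reflections_generate_dim
  refine ⟨l.map WithLp.ofLp, (toEuclideanCLM (𝕜 := ℝ) (n := n)).injective ?_⟩
  have hprod : ∀ l : List (EuclideanSpace ℝ n),
      (((l.map fun v => (ℝ ∙ v)ᗮ.reflection).prod :
        EuclideanSpace ℝ n ≃ₗᵢ[ℝ] EuclideanSpace ℝ n) :
        EuclideanSpace ℝ n →L[ℝ] EuclideanSpace ℝ n) =
      toEuclideanCLM (𝕜 := ℝ) ((l.map WithLp.ofLp).map householder).prod := by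
    intro l
    induction l with
    | nil => simp
    | cons v l ih =>
      simp only [List.map_cons, List.prod_cons, map_mul, toEuclideanCLM_householder, ← ih]
      rfl
  exact (congrArg (fun φ : EuclideanSpace ℝ n ≃ₗᵢ[ℝ] EuclideanSpace ℝ n =>
    (φ : EuclideanSpace ℝ n →L[ℝ] EuclideanSpace ℝ n)) hl).trans (hprod l)

end Householder

section AnalyticCurve

variable {n : Type*} [Fintype n] [DecidableEq n]

/-- Two matrices are joined by a real-analytic curve `ℝ → O(n)`, at times `0` and `1`. -/
def AnalyticallyJoined (A B : Matrix n n ℝ) : Prop :=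
  ∃ c : ℝ → Matrix n n ℝ, (∀ i j t, AnalyticAt ℝ (fun s => c s i j) t) ∧
    (∀ t, (c t)ᵀ * c t = 1) ∧ c 0 = A ∧ c 1 = B

theorem AnalyticallyJoined.refl {A : Matrix n n ℝ} (hA : Aᵀ * A = 1) : AnalyticallyJoined A A :=
  ⟨fun _ => A, fun _ _ _ => analyticAt_const, fun _ => hA, rfl, rfl⟩

theorem AnalyticallyJoined.mul {A B A' B' : Matrix n n ℝ} (h : AnalyticallyJoined A B)
    (h' : AnalyticallyJoined A' B') : AnalyticallyJoined (A * A') (B * B') := by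
  obtain ⟨c, hc, ho, rfl, rfl⟩ := h
  obtain ⟨c', hc', ho', rfl, rfl⟩ := h'
  refine ⟨fun t => c t * c' t, fun i j t => ?_, fun t => ?_, rfl, rfl⟩
  · simp only [mul_apply]
    exact Finset.analyticAt_fun_sum _ fun k _ => (hc i k t).mul (hc' k j t)
  · rw [transpose_mul, mul_assoc, ← mul_assoc (c t)ᵀ, ho, one_mul, ho']

theorem continuous_det_of_analyticAt {c : ℝ → Matrix n n ℝ}
    (hc : ∀ i j t, AnalyticAt ℝ (fun s => c s i j) t) : Continuous fun t => (c t).det :=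
  (continuous_matrix fun i j => continuous_iff_continuousAt.2 fun t =>
    (hc i j t).continuousAt).matrix_det

theorem det_eq_of_analyticAt {c : ℝ → Matrix n n ℝ}
    (hc : ∀ i j t, AnalyticAt ℝ (fun s => c s i j) t) (ho : ∀ t, (c t)ᵀ * c t = 1) (s t : ℝ) :
    (c s).det = (c t).det := by
  have hsq : ∀ t, (c t).det ^ 2 = 1 := fun t => by
    simpa [sq] using congrArg det (ho t)
  rcases isPreconnected_univ.eq_one_or_eq_neg_one_of_sq_eq
    (continuous_det_of_analyticAt hc).continuousOn (fun t _ => hsq t) with h | h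
  · exact (h (Set.mem_univ s)).trans (h (Set.mem_univ t)).symm
  · exact (h (Set.mem_univ s)).trans (h (Set.mem_univ t)).symm

theorem analyticallyJoined_householder {u v : n → ℝ} (hu : u ≠ 0) (hv : v ≠ 0) :
    AnalyticallyJoined (householder u) (householder v) := by
  by_cases h : ∃ a : ℝ, a • u = v
  · obtain ⟨a, rfl⟩ := h
    have ha : a ≠ 0 := by rintro rfl; simp at hv
    rw [householder_smul ha]
    exact .refl (by rw [householder_transpose, householder_mul_self])
  have hne : ∀ t : ℝ, (1 - t) • u + t • v ≠ 0 := by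
    intro t ht
    rcases eq_or_ne t 0 with rfl | h0
    · simp [hu] at ht
    · refine h ⟨-(t⁻¹ * (1 - t)), ?_⟩
      rw [neg_smul, mul_smul, eq_neg_of_add_eq_zero_left ht, smul_neg, neg_neg, smul_smul,
        inv_mul_cancel₀ h0, one_smul]
  refine ⟨fun t => householder ((1 - t) • u + t • v), fun i j t => ?_, fun t => ?_, ?_, ?_⟩
  · have hlin : ∀ k, AnalyticAt ℝ (fun s : ℝ => ((1 - s) • u + s • v) k) t := fun k => by
      simp only [Pi.add_apply, Pi.smul_apply, smul_eq_mul]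
      fun_prop
    simp only [householder_apply]
    refine analyticAt_const.sub ((analyticAt_const.div ?_ ?_).mul ((hlin i).mul (hlin j)))
    · exact Finset.analyticAt_fun_sum _ fun k _ => (hlin k).mul (hlin k)
    · exact dotProduct_self_eq_zero.not.2 (hne t)
  · rw [householder_transpose, householder_mul_self]
  · simp
  · simp

theorem analyticallyJoined_one_or_householder {e : n → ℝ} (he : e ≠ 0) {M : Matrix n n ℝ}
    (hM : Mᵀ * M = 1) : AnalyticallyJoined 1 M ∨ AnalyticallyJoined (householder e) M := by
  obtain ⟨l, rfl⟩ := exists_eq_prod_householder hM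
  clear hM
  induction l with
  | nil => exact .inl (.refl (by simp))
  | cons v l ih =>
    rw [List.map_cons, List.prod_cons]
    rcases eq_or_ne v 0 with rfl | hv
    · simpa using ih
    have h := analyticallyJoined_householder he hv
    rcases ih with ih | ih
    · exact .inr (by simpa using h.mul ih)
    · exact .inl (by simpa [householder_mul_self] using h.mul ih)

theorem analyticallyJoined_one [Nonempty n] {M : Matrix n n ℝ} (hM : Mᵀ * M = 1)
    (hdet : M.det = 1) : AnalyticallyJoined 1 M := by
  have he : (1 : n → ℝ) ≠ 0 := one_ne_zero
  refine (analyticallyJoined_one_or_householder he hM).resolve_right ?_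
  rintro ⟨c, hc, ho, h0, h1⟩
  have := det_eq_of_analyticAt hc ho 0 1
  rw [h0, h1, det_householder he, hdet] at this
  norm_num at this

end AnalyticCurve

theorem exists_analyticAt_curve_mem_SOSet {d : ℕ} [NeZero d] {A B : Matrix (Fin d) (Fin d) ℝ}
    (hA : A ∈ SOSet d) (hB : B ∈ SOSet d) :
    ∃ c : ℝ → Matrix (Fin d) (Fin d) ℝ, (∀ i j t, AnalyticAt ℝ (fun s => c s i j) t) ∧
      (∀ t, c t ∈ SOSet d) ∧ c 0 = A ∧ c 1 = B := by
  have hAA : A * Aᵀ = 1 := mul_eq_one_comm.mp hA.1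
  have hBA : (Aᵀ * B)ᵀ * (Aᵀ * B) = 1 := by
    rw [transpose_mul, transpose_transpose, mul_assoc, ← mul_assoc A, hAA, one_mul, hB.1]
  have hj := (AnalyticallyJoined.refl hA.1).mul
    (analyticallyJoined_one hBA (by rw [det_mul, det_transpose, hA.2, hB.2, one_mul]))
  rw [mul_one, ← mul_assoc, hAA, one_mul] at hj
  obtain ⟨c, hc, ho, h0, h1⟩ := hj
  exact ⟨c, hc, fun t => ⟨ho t, by rw [det_eq_of_analyticAt hc ho t 0, h0, hA.2]⟩, h0, h1⟩

theorem analyticAt_aeval_rat {σ : Type*} (p : MvPolynomial σ ℚ) {f : ℝ → σ → ℝ} {t : ℝ}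
    (hf : ∀ q, AnalyticAt ℝ (fun s => f s q) t) :
    AnalyticAt ℝ (fun s => MvPolynomial.aeval (f s) p) t := by
  simp only [MvPolynomial.aeval_def, MvPolynomial.eval₂_eq]
  exact Finset.analyticAt_fun_sum _ fun m _ => analyticAt_const.mul <|
    Finset.analyticAt_fun_prod _ fun q _ => (hf q).pow _

theorem continuous_aeval_rat {X σ : Type*} [TopologicalSpace X] (p : MvPolynomial σ ℚ)
    {f : X → σ → ℝ} (hf : ∀ q, Continuous fun x => f x q) :
    Continuous fun x => MvPolynomial.aeval (f x) p := by
  simp only [MvPolynomial.aeval_def, MvPolynomial.eval₂_eq]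
  exact continuous_finsetSum _ fun m _ => continuous_const.mul <|
    continuous_finsetProd _ fun q _ => (hf q).pow _

/-- The identity principle for polynomials on `SO(d)^r`. -/
theorem aeval_eq_zero_of_eventually_eq_zero {d r : ℕ} [NeZero d]
    (p : MvPolynomial (Fin r × Fin d × Fin d) ℚ)
    (γ : {x : Fin r → Matrix (Fin d) (Fin d) ℝ // ∀ s, x s ∈ SOSet d})
    (hγ : ∀ᶠ x in 𝓝 γ, MvPolynomial.aeval (fun q => x.1 q.1 q.2.1 q.2.2) p = (0 : ℝ))
    (β : Fin r → Matrix (Fin d) (Fin d) ℝ) (hβ : ∀ s, β s ∈ SOSet d) :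
    MvPolynomial.aeval (fun q => β q.1 q.2.1 q.2.2) p = (0 : ℝ) := by
  choose c hc hmem h0 h1 using fun s => exists_analyticAt_curve_mem_SOSet (γ.2 s) (hβ s)
  let C : ℝ → {x : Fin r → Matrix (Fin d) (Fin d) ℝ // ∀ s, x s ∈ SOSet d} :=
    fun t => ⟨fun s => c s t, fun s => hmem s t⟩
  have hC : Continuous C := Continuous.subtype_mk (continuous_pi fun s =>
    continuous_matrix fun i j => continuous_iff_continuousAt.2 fun t =>
      (hc s i j t).continuousAt) _
  have hC0 : C 0 = γ := Subtype.ext (funext h0)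
  have han : AnalyticOnNhd ℝ
      (fun t => MvPolynomial.aeval (fun q => c q.1 t q.2.1 q.2.2) p) Set.univ :=
    fun t _ => analyticAt_aeval_rat p fun q => hc q.1 q.2.1 q.2.2 t
  have hev := (hC.tendsto 0).eventually (by rwa [hC0])
  have := han.eqOn_zero_of_preconnected_of_eventuallyEq_zero isPreconnected_univ
    (Set.mem_univ 0) hev (Set.mem_univ 1)
  simpa [h1] using this

/-- The set of non-generic tuples is meager in `SO(d)^r`, the latter carrying the
topology induced from the Euclidean topology on `ℝ^{d²r}`. -/
theorem nongeneric_meager (d r : ℕ) (hd : 2 ≤ d) (hr : 1 ≤ r) :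
    IsMeagre {γ : {x : Fin r → Matrix (Fin d) (Fin d) ℝ // ∀ s, x s ∈ SOSet d} |
      ¬ IsGeneric (fun s => γ.1 s)} := by
  have : NeZero d := ⟨by omega⟩
  let Z (p : MvPolynomial (Fin r × Fin d × Fin d) ℚ) :
      Set {x : Fin r → Matrix (Fin d) (Fin d) ℝ // ∀ s, x s ∈ SOSet d} :=
    {γ | MvPolynomial.aeval (fun q => γ.1 q.1 q.2.1 q.2.2) p = (0 : ℝ)}
  have hclosed : ∀ p, IsClosed (Z p) := fun p => by
    have hcont := continuous_aeval_rat p (f := fun (γ : {x : Fin r → Matrix (Fin d) (Fin d) ℝ //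
        ∀ s, x s ∈ SOSet d}) q => γ.1 q.1 q.2.1 q.2.2) fun q =>
      ((continuous_apply q.1).comp continuous_subtype_val).matrix_elem q.2.1 q.2.2
    exact isClosed_singleton.preimage hcont
  have : Countable (MvPolynomial (Fin r × Fin d × Fin d) ℚ) :=
    Cardinal.mk_le_aleph0_iff.1 (MvPolynomial.cardinalMk_le_max.trans
      (by simpa only [max_le_iff, le_refl, and_true] using
        ⟨Cardinal.mk_le_aleph0, Cardinal.mk_le_aleph0⟩))
  have hmeagre (p : {p // interior (Z p) = ∅}) : IsMeagre (Z p.1) :=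
    IsNowhereDense.isMeagre ((hclosed p.1).isNowhereDense_iff.2 p.2)
  refine IsMeagre.mono (fun γ hγ => ?_) (isMeagre_iUnion hmeagre)
  simp only [Set.mem_ofPred_eq, IsGeneric, not_forall] at hγ
  obtain ⟨p, hp, β, hβ, hne⟩ := hγ
  refine Set.mem_iUnion.2 ⟨⟨p, Set.eq_empty_iff_forall_notMem.2 fun x hx => hne ?_⟩, hp⟩
  exact aeval_eq_zero_of_eventually_eq_zero p x (mem_interior_iff_mem_nhds.1 hx) β hβ
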